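/- Assume the sequence R_1, …, R_m is disjoint-superset and d_i ≥ 1 for every i. Let 1 ≤ j ≤ i ≤ m and let c, c' ∈ R_j be coins such that Pr_k(c) > 0 and Pr_k(c') > 0 for all k with i ≤ k ≤ m. If Pr_i(r_j | c) ≥ Pr_i(r_j | c') > 0 and Pr_i(r_j | c) = β · Pr_i(r_j | c'), then for every k with i ≤ k ≤ m: Pr_k(r_j | c) ≥ Pr_k(r_j | c') and Pr_k(r_j | c) ≤ β · Pr_k(r_j | c'). -/

import Mathlib

open scoped Classical

/-- The spent coin permutations for the first `k` ring signatures of the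
sequence `R` (rings are indexed from `1`): injective functions `σ : Fin k → C`
with `σ(j) ∈ R_j` for each `j ∈ {1, …, k}` (position `j` of `σ` is `j - 1`). -/
noncomputable def perms {C : Type*} [Fintype C] [DecidableEq C]
    (R : ℕ → Finset C) (k : ℕ) : Finset (Fin k → C) :=
  Finset.univ.filter fun σ => Function.Injective σ ∧ ∀ j : Fin k, σ j ∈ R (j.1 + 1)

/-- `N_k`, the number of spent coin permutations for the first `k` ring signatures. -/
noncomputable def numPerms {C : Type*} [Fintype C] [DecidableEq C]
    (R : ℕ → Finset C) (k : ℕ) : ℕ :=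
  (perms R k).card

/-- `Pr_k(c, r_j)`: the fraction of spent coin permutations `σ` for the first `k`
ring signatures with `σ(j) = c`. -/
noncomputable def prSpentIn {C : Type*} [Fintype C] [DecidableEq C]
    (R : ℕ → Finset C) (k j : ℕ) (c : C) : ℝ :=
  (((perms R k).filter fun σ => ∃ h : j - 1 < k, σ ⟨j - 1, h⟩ = c).card : ℝ) /
    (numPerms R k : ℝ)

/-- `Pr_k(c)`: the fraction of spent coin permutations `σ` for the first `k`
ring signatures having `c` in their image. -/
noncomputable def prSpent {C : Type*} [Fintype C] [DecidableEq C]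
    (R : ℕ → Finset C) (k : ℕ) (c : C) : ℝ :=
  (((perms R k).filter fun σ => ∃ j, σ j = c).card : ℝ) / (numPerms R k : ℝ)

/-- `Pr_k(r_j | c) = Pr_k(c, r_j) / Pr_k(c)`. -/
noncomputable def prCond {C : Type*} [Fintype C] [DecidableEq C]
    (R : ℕ → Finset C) (k j : ℕ) (c : C) : ℝ :=
  prSpentIn R k j c / prSpent R k c

/-- The first `m` ring signatures of `R` are disjoint-superset: for all
`1 ≤ j < i ≤ m`, either `R_i ∩ R_j = ∅` or `R_j ⊆ R_i`. -/
def DisjointSuperset {C : Type*} [Fintype C] [DecidableEq C]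
    (R : ℕ → Finset C) (m : ℕ) : Prop :=
  ∀ i j, 1 ≤ j → j < i → i ≤ m → Disjoint (R i) (R j) ∨ R j ⊆ R i

/-- `ns_i`: the number of indices `j < i` with `R_j ⊆ R_i`. -/
noncomputable def nsub {C : Type*} [Fintype C] [DecidableEq C]
    (R : ℕ → Finset C) (i : ℕ) : ℕ :=
  ((Finset.Ico 1 i).filter fun j => R j ⊆ R i).card

/-- The degree `d_i = |R_i| - ns_i`. -/
noncomputable def deg {C : Type*} [Fintype C] [DecidableEq C]
    (R : ℕ → Finset C) (i : ℕ) : ℕ :=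
  (R i).card - nsub R i

section counting

variable {C : Type*} [Fintype C] [DecidableEq C] (R : ℕ → Finset C)

lemma snoc_mem_perms_succ {k : ℕ} (τ : Fin k → C) (x : C) :
    (Fin.snoc τ x : Fin (k + 1) → C) ∈ perms R (k + 1) ↔
      τ ∈ perms R k ∧ x ∈ R (k + 1) ∧ ∀ l, τ l ≠ x := by
  simp only [perms, Finset.mem_filter, Finset.mem_univ, true_and, Fin.snoc_injective_iff,
    Fin.forall_fin_succ', Fin.snoc_castSucc, Fin.snoc_last, Set.mem_range, not_exists,
    Fin.val_castSucc, Fin.val_last]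
  tauto

/-- In a disjoint-superset sequence every spent coin permutation leaves exactly `d_{k+1}` coins
for the next ring. -/
lemma card_available_eq_deg {m k : ℕ} (hds : DisjointSuperset R m) (hk : k + 1 ≤ m)
    {τ : Fin k → C} (hτ : τ ∈ perms R k) :
    ((R (k + 1)).filter fun x => ∀ l, τ l ≠ x).card = deg R (k + 1) := by
  simp only [perms, Finset.mem_filter, Finset.mem_univ, true_and] at hτ
  obtain ⟨hinj, hmem⟩ := hτ
  have hused : ((R (k + 1)).filter fun x => ¬ ∀ l, τ l ≠ x).card = nsub R (k + 1) := by
    unfold nsub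
    symm
    refine Finset.card_bij (fun a ha => τ ⟨a - 1, ?_⟩) ?_ ?_ ?_
    · simp only [Finset.mem_filter, Finset.mem_Ico] at ha
      omega
    · intro a ha
      simp only [Finset.mem_filter, Finset.mem_Ico] at ha
      have h := hmem ⟨a - 1, by omega⟩
      simp only [Nat.sub_add_cancel ha.1.1] at h
      simp only [Finset.mem_filter, not_forall, not_not]
      exact ⟨ha.2 h, _, rfl⟩
    · intro a ha b hb hab
      simp only [Finset.mem_filter, Finset.mem_Ico] at ha hb
      have h := congrArg Fin.val (hinj hab)
      simp only at h
      omega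
    · intro x hx
      simp only [Finset.mem_filter, not_forall, not_not] at hx
      obtain ⟨hxR, l, rfl⟩ := hx
      refine ⟨l.1 + 1, ?_, by simp⟩
      simp only [Finset.mem_filter, Finset.mem_Ico]
      refine ⟨by omega, ?_⟩
      rcases hds (k + 1) (l.1 + 1) (by omega) (by omega) hk with h | h
      · exact absurd (hmem l) (Finset.disjoint_left.mp h hxR)
      · exact h
  have hsum := Finset.card_filter_add_card_filter_not (s := R (k + 1)) (fun x => ∀ l, τ l ≠ x)
  unfold deg
  omega

lemma card_filter_init {m k : ℕ} (hds : DisjointSuperset R m) (hk : k + 1 ≤ m)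
    (P : (Fin k → C) → Prop) [DecidablePred P] :
    ((perms R (k + 1)).filter fun σ => P (Fin.init σ)).card =
      ((perms R k).filter P).card * deg R (k + 1) := by
  rw [Finset.card_eq_sum_card_fiberwise (f := fun σ => Fin.init σ) (t := (perms R k).filter P)]
  · rw [Finset.sum_const_nat]
    intro τ hτ
    rw [Finset.mem_filter] at hτ
    rw [← card_available_eq_deg R hds hk hτ.1]
    symm
    refine Finset.card_bij (fun x _ => Fin.snoc τ x) ?_ ?_ ?_
    · intro x hx
      rw [Finset.mem_filter] at hx
      simp only [Finset.mem_filter, snoc_mem_perms_succ, Fin.init_snoc, and_true]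
      exact ⟨⟨hτ.1, hx⟩, hτ.2⟩
    · intro x _ y _ hxy
      simpa using congrFun hxy (Fin.last k)
    · intro σ hσ
      simp only [Finset.mem_filter] at hσ
      obtain ⟨⟨hσ, -⟩, rfl⟩ := hσ
      rw [← Fin.snoc_init_self σ, snoc_mem_perms_succ] at hσ
      exact ⟨σ (Fin.last k), Finset.mem_filter.mpr hσ.2, Fin.snoc_init_self σ⟩
  · intro σ hσ
    simp only [Finset.coe_filter, Set.mem_ofPred_eq] at hσ ⊢
    refine ⟨?_, hσ.2⟩
    have h := hσ.1
    rw [← Fin.snoc_init_self σ, snoc_mem_perms_succ] at h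
    exact h.1

lemma card_filter_last_eq {k : ℕ} {x : C} (hx : x ∈ R (k + 1)) :
    ((perms R (k + 1)).filter fun σ => σ (Fin.last k) = x).card =
      ((perms R k).filter fun τ => ¬ ∃ l, τ l = x).card := by
  symm
  refine Finset.card_bij (fun τ _ => Fin.snoc τ x) ?_ ?_ ?_
  · intro τ hτ
    simp only [Finset.mem_filter, not_exists] at hτ
    simp only [Finset.mem_filter, snoc_mem_perms_succ, Fin.snoc_last, and_true]
    exact ⟨hτ.1, hx, hτ.2⟩
  · intro τ _ τ' _ h
    simpa using congrArg Fin.init h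
  · intro σ hσ
    simp only [Finset.mem_filter] at hσ
    obtain ⟨hσ, rfl⟩ := hσ
    rw [← Fin.snoc_init_self σ, snoc_mem_perms_succ] at hσ
    simp only [Finset.mem_filter, not_exists]
    exact ⟨Fin.init σ, ⟨hσ.1, hσ.2.2⟩, Fin.snoc_init_self σ⟩

lemma numPerms_succ {m k : ℕ} (hds : DisjointSuperset R m) (hk : k + 1 ≤ m) :
    numPerms R (k + 1) = numPerms R k * deg R (k + 1) := by
  simpa [numPerms] using card_filter_init R hds hk fun _ => True

lemma numPerms_pos {m k : ℕ} (hds : DisjointSuperset R m)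
    (hdeg : ∀ i, 1 ≤ i → i ≤ m → 1 ≤ deg R i) (hk : k ≤ m) : 0 < numPerms R k := by
  induction k with
  | zero =>
    refine Finset.card_pos.mpr ⟨Fin.elim0, ?_⟩
    simp only [perms, Finset.mem_filter, Finset.mem_univ, true_and]
    exact ⟨Function.injective_of_subsingleton _, fun l => l.elim0⟩
  | succ k ih =>
    rw [numPerms_succ R hds hk]
    exact Nat.mul_pos (ih (by omega)) (hdeg _ (by omega) hk)

lemma prSpentIn_succ_of_le {m k j : ℕ} (hds : DisjointSuperset R m)
    (hdeg : ∀ i, 1 ≤ i → i ≤ m → 1 ≤ deg R i) (hk : k + 1 ≤ m) (hj : 1 ≤ j) (hjk : j ≤ k)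
    (x : C) : prSpentIn R (k + 1) j x = prSpentIn R k j x := by
  have h := card_filter_init R hds hk fun τ => ∃ h : j - 1 < k, τ ⟨j - 1, h⟩ = x
  have hset : ((perms R (k + 1)).filter fun σ => ∃ h : j - 1 < k + 1, σ ⟨j - 1, h⟩ = x) =
      (perms R (k + 1)).filter fun σ => ∃ h : j - 1 < k, Fin.init σ ⟨j - 1, h⟩ = x := by
    refine Finset.filter_congr fun σ _ => ?_
    have h1 : j - 1 < k := by omega
    have h2 : j - 1 < k + 1 := by omega
    simp only [h1, h2, exists_true_left]
    rfl
  have hd : (deg R (k + 1) : ℝ) ≠ 0 := by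
    have := hdeg (k + 1) (by omega) hk
    positivity
  unfold prSpentIn
  rw [hset, h, numPerms_succ R hds hk]
  push_cast
  exact mul_div_mul_right _ _ hd

lemma one_sub_prSpent {m k : ℕ} (hds : DisjointSuperset R m)
    (hdeg : ∀ i, 1 ≤ i → i ≤ m → 1 ≤ deg R i) (hk : k ≤ m) (x : C) :
    1 - prSpent R k x = (((perms R k).filter fun τ => ¬ ∃ l, τ l = x).card : ℝ) / numPerms R k := by
  have hN : (numPerms R k : ℝ) ≠ 0 := by
    exact_mod_cast (numPerms_pos R hds hdeg hk).ne'
  have h := Finset.card_filter_add_card_filter_not (s := perms R k) (fun τ => ∃ l, τ l = x)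
  have h' : (((perms R k).filter fun τ => ∃ l, τ l = x).card : ℝ) +
      ((perms R k).filter fun τ => ¬ ∃ l, τ l = x).card = numPerms R k := by
    exact_mod_cast h
  unfold prSpent
  rw [eq_div_iff hN, sub_mul, div_mul_cancel₀ _ hN]
  linarith

lemma prSpentIn_last {m k : ℕ} (hds : DisjointSuperset R m)
    (hdeg : ∀ i, 1 ≤ i → i ≤ m → 1 ≤ deg R i) (hk : k + 1 ≤ m) {x : C} (hx : x ∈ R (k + 1)) :
    prSpentIn R (k + 1) (k + 1) x = (1 - prSpent R k x) / deg R (k + 1) := by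
  have hset : ((perms R (k + 1)).filter
      fun σ => ∃ h : k + 1 - 1 < k + 1, σ ⟨k + 1 - 1, h⟩ = x) =
      (perms R (k + 1)).filter fun σ => σ (Fin.last k) = x := by
    refine Finset.filter_congr fun σ _ => ?_
    simp [Fin.last]
  unfold prSpentIn
  rw [one_sub_prSpent R hds hdeg (by omega), hset, card_filter_last_eq R hx,
    numPerms_succ R hds hk, div_div]
  push_cast
  rfl

lemma prSpent_succ {m k : ℕ} (hds : DisjointSuperset R m)
    (hdeg : ∀ i, 1 ≤ i → i ≤ m → 1 ≤ deg R i) (hk : k + 1 ≤ m) (x : C) :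
    prSpent R (k + 1) x = prSpent R k x + prSpentIn R (k + 1) (k + 1) x := by
  have hd : (deg R (k + 1) : ℝ) ≠ 0 := by
    have := hdeg (k + 1) (by omega) hk
    positivity
  have hcard : ((perms R (k + 1)).filter fun σ => ∃ l, σ l = x).card =
      ((perms R k).filter fun τ => ∃ l, τ l = x).card * deg R (k + 1) +
      ((perms R (k + 1)).filter
        fun σ => ∃ h : k + 1 - 1 < k + 1, σ ⟨k + 1 - 1, h⟩ = x).card := by
    rw [← card_filter_init R hds hk fun τ => ∃ l, τ l = x, ← Finset.card_union_of_disjoint, ← Finset.filter_or]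
    · congr 1
      refine Finset.filter_congr fun σ _ => ?_
      simp [Fin.exists_fin_succ', Fin.init, Fin.last]
    · rw [Finset.disjoint_filter]
      rintro σ hσ ⟨l, hl⟩ ⟨h, hx⟩
      simp only [perms, Finset.mem_filter] at hσ
      have := congrArg Fin.val (hσ.2.1 (hl.trans hx.symm))
      simp at this
      omega
  unfold prSpent prSpentIn
  rw [hcard, numPerms_succ R hds hk]
  push_cast
  rw [add_div, mul_div_mul_right _ _ hd]

lemma prSpentIn_eq_zero {k : ℕ} {x : C} (hx : x ∉ R (k + 1)) :
    prSpentIn R (k + 1) (k + 1) x = 0 := by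
  have : ((perms R (k + 1)).filter
      fun σ => ∃ h : k + 1 - 1 < k + 1, σ ⟨k + 1 - 1, h⟩ = x) = ∅ := by
    refine Finset.filter_eq_empty_iff.mpr ?_
    rintro σ hσ ⟨h, rfl⟩
    simp only [perms, Finset.mem_filter] at hσ
    exact hx (hσ.2.2 _)
  unfold prSpentIn
  rw [this]
  simp

/-- The probability that a coin of `R_j` is unspent is a common multiple of the probability that
it is spent in the `j`-th ring. -/
lemma exists_one_sub_prSpent_eq_mul {m j : ℕ} (hds : DisjointSuperset R m)
    (hdeg : ∀ i, 1 ≤ i → i ≤ m → 1 ≤ deg R i) (hj : 1 ≤ j) (hjm : j ≤ m) :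
    ∃ μ : ℝ, 0 ≤ μ ∧ ∀ x ∈ R j, 1 - prSpent R j x = μ * prSpentIn R j j x := by
  obtain ⟨k, rfl⟩ : ∃ k, j = k + 1 := ⟨j - 1, by omega⟩
  have hd : (1 : ℝ) ≤ deg R (k + 1) := by exact_mod_cast hdeg (k + 1) hj hjm
  refine ⟨deg R (k + 1) - 1, by linarith, fun x hx => ?_⟩
  rw [prSpent_succ R hds hdeg hjm, prSpentIn_last R hds hdeg hjm hx]
  field_simp
  ring

/-- The common multiple relating unspent probabilities to `Pr_k(x, r_j)` can only decrease. -/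
lemma exists_le_one_sub_prSpent_eq_mul {m i j k : ℕ} (hds : DisjointSuperset R m)
    (hdeg : ∀ i, 1 ≤ i → i ≤ m → 1 ≤ deg R i) (hj : 1 ≤ j) (hji : j ≤ i) (hik : i ≤ k)
    (hkm : k ≤ m) {μ : ℝ} (hμ : 0 ≤ μ)
    (h : ∀ x ∈ R j, 1 - prSpent R i x = μ * prSpentIn R i j x) :
    ∃ ν : ℝ, 0 ≤ ν ∧ ν ≤ μ ∧ ∀ x ∈ R j, prSpentIn R k j x = prSpentIn R i j x ∧
      1 - prSpent R k x = ν * prSpentIn R i j x := by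
  induction k, hik using Nat.le_induction with
  | base => exact ⟨μ, hμ, le_rfl, fun x hx => ⟨rfl, h x hx⟩⟩
  | succ k hik ih =>
    obtain ⟨ν, hν, hνμ, hx⟩ := ih (by omega)
    have hIn := prSpentIn_succ_of_le R hds hdeg hkm hj (hji.trans hik)
    have hd : (1 : ℝ) ≤ deg R (k + 1) := by exact_mod_cast hdeg (k + 1) (by omega) hkm
    rcases hds (k + 1) j hj (by omega) hkm with hdisj | hsub
    · refine ⟨ν, hν, hνμ, fun x hxj => ⟨(hIn x).trans (hx x hxj).1, ?_⟩⟩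
      rw [prSpent_succ R hds hdeg hkm, prSpentIn_eq_zero R (Finset.disjoint_right.mp hdisj hxj),
        add_zero, (hx x hxj).2]
    · have hinv : (deg R (k + 1) : ℝ)⁻¹ ≤ 1 := inv_le_one_of_one_le₀ hd
      have hinv0 : 0 ≤ (deg R (k + 1) : ℝ)⁻¹ := by positivity
      refine ⟨(1 - (deg R (k + 1) : ℝ)⁻¹) * ν, mul_nonneg (by linarith) hν, ?_,
        fun x hxj => ⟨(hIn x).trans (hx x hxj).1, ?_⟩⟩
      · nlinarith
      · rw [prSpent_succ R hds hdeg hkm, prSpentIn_last R hds hdeg hkm (hsub hxj)]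
        rw [mul_assoc, ← (hx x hxj).2]
        ring

end counting

theorem stmt6 {C : Type*} [Fintype C] [DecidableEq C]
    (R : ℕ → Finset C) (m : ℕ)
    (hne : ∀ i, 1 ≤ i → i ≤ m → (R i).Nonempty)
    (hds : DisjointSuperset R m)
    (hdeg : ∀ i, 1 ≤ i → i ≤ m → 1 ≤ deg R i)
    (i j : ℕ) (hj : 1 ≤ j) (hji : j ≤ i) (him : i ≤ m)
    (c c' : C) (hc : c ∈ R j) (hc' : c' ∈ R j) (β : ℝ)
    (hpos : ∀ k, i ≤ k → k ≤ m → 0 < prSpent R k c ∧ 0 < prSpent R k c')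
    (hge : prCond R i j c' ≤ prCond R i j c)
    (hpos' : 0 < prCond R i j c')
    (hβ : prCond R i j c = β * prCond R i j c') :
    ∀ k, i ≤ k → k ≤ m →
      prCond R k j c' ≤ prCond R k j c ∧ prCond R k j c ≤ β * prCond R k j c' := by
  intro k hik hkm
  obtain ⟨μ₀, hμ₀, h₀⟩ := exists_one_sub_prSpent_eq_mul R hds hdeg hj (hji.trans him)
  obtain ⟨μ, hμ, -, hi⟩ :=
    exists_le_one_sub_prSpent_eq_mul R hds hdeg hj le_rfl hji him hμ₀ h₀
  replace hi : ∀ x ∈ R j, 1 - prSpent R i x = μ * prSpentIn R i j x := fun x hx => by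
    rw [(hi x hx).1, (hi x hx).2]
  obtain ⟨ν, hν, hνμ, hk⟩ :=
    exists_le_one_sub_prSpent_eq_mul R hds hdeg hj hji hik hkm hμ hi
  obtain ⟨hq, hq'⟩ := hpos i le_rfl him
  obtain ⟨hr, hr'⟩ := hpos k hik hkm
  have hp' : 0 < prSpentIn R i j c' := by
    have := mul_pos hpos' hq'
    rwa [prCond, div_mul_cancel₀ _ hq'.ne'] at this
  have hic := hi c hc
  have hic' := hi c' hc'
  obtain ⟨hpc, hkc⟩ := hk c hc
  obtain ⟨hpc', hkc'⟩ := hk c' hc'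
  unfold prCond at *
  rw [hpc, hpc']
  generalize prSpentIn R i j c = p at *
  generalize prSpentIn R i j c' = p' at *
  generalize prSpent R i c = q at *
  generalize prSpent R i c' = q' at *
  generalize prSpent R k c = r at *
  generalize prSpent R k c' = r' at *
  obtain rfl : q = 1 - μ * p := by linarith
  obtain rfl : q' = 1 - μ * p' := by linarith
  obtain rfl : r = 1 - ν * p := by linarith
  obtain rfl : r' = 1 - ν * p' := by linarith
  have hpp : p' ≤ p := by
    rw [div_le_div_iff₀ hq' hq] at hge
    linarith
  refine ⟨by rw [div_le_div_iff₀ hr' hr]; linarith, ?_⟩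
  obtain rfl : β = p * (1 - μ * p') / (p' * (1 - μ * p)) := by
    field_simp at hβ ⊢
    linarith
  rw [div_mul_div_comm, div_le_div_iff₀ hr (by positivity)]
  have key : 0 ≤ p * p' * ((μ - ν) * (p - p')) :=
    mul_nonneg (mul_nonneg (hp'.le.trans hpp) hp'.le)
      (mul_nonneg (sub_nonneg.mpr hνμ) (sub_nonneg.mpr hpp))
  linarith
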